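/- Fix a, ρ, λ, μ with ρ > 0, μ > 0, λ + 2μ > 0, a > 0, and regard Z_M, Z_L, Z_T and Z (via the lumped formula) as functions of ω > 0. In the perfectly bonded case Z_S = Z_T one has lim_{ω→0⁺} iω Z(ω) = 12πaμ/(2 + κ^{−2}), where κ^{−2} = μ/(λ+2μ). In the lubricated (pure slip, z_I = 0) case, where Z_S is defined by 1/Z_S = 1/Z_T + iω/(8πaμ), one has lim_{ω→0⁺} iω Z(ω) = 12πaμ/(3 + κ^{−2}). -/

import Mathlib

open Complex Filter Topology

/-- Mass-like impedance `Z_M = iω(4/3)πa³ρ`. -/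
noncomputable def ZMf (a ρ ω : ℝ) : ℂ := I * ω * (4 / 3) * Real.pi * a ^ 3 * ρ

/-- Longitudinal impedance `Z_L = (iω)⁻¹ 4πa(λ+2μ)(1−ika)`, `k = ω/c_L`. -/
noncomputable def ZLf (a ρ lam mu ω : ℝ) : ℂ :=
  (I * ω)⁻¹ * (4 * Real.pi * a * (lam + 2 * mu))
    * (1 - I * (ω / Real.sqrt ((lam + 2 * mu) / ρ)) * a)

/-- Transverse impedance `Z_T = (iω)⁻¹ 4πaμ(1−iha)`, `h = ω/c_T`. -/
noncomputable def ZTf (a ρ mu ω : ℝ) : ℂ :=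
  (I * ω)⁻¹ * (4 * Real.pi * a * mu) * (1 - I * (ω / Real.sqrt (mu / ρ)) * a)

/-- The sphere impedance `Z` given by the lumped formula
`3/(Z+Z_M) = 1/(Z_L+Z_M) + 2/(Z_S+Z_M)`. -/
noncomputable def Zsphere (ZM ZL ZS : ℂ) : ℂ :=
  3 / (1 / (ZL + ZM) + 2 / (ZS + ZM)) - ZM

theorem Zsphere_scale (w A B C : ℂ) (_hw : w ≠ 0) :
    w * Zsphere A B C = Zsphere (w * A) (w * B) (w * C) := by
  unfold Zsphere
  have h : 1 / (w * B + w * A) + 2 / (w * C + w * A)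
      = w⁻¹ * (1 / (B + A) + 2 / (C + A)) := by
    rw [← mul_add, ← mul_add]
    simp only [div_eq_mul_inv, mul_inv]
    ring
  rw [h]
  simp only [div_eq_mul_inv, mul_inv, inv_inv]
  ring

theorem Zsphere_tendsto (ZM ZL ZS : ℝ → ℂ) (L S : ℝ) (hL : 0 < L) (hS : 0 < S)
    (hM : Tendsto (fun ω : ℝ => I * ω * ZM ω) (𝓝[>] 0) (𝓝 0))
    (h1 : Tendsto (fun ω : ℝ => I * ω * ZL ω) (𝓝[>] 0) (𝓝 (L : ℂ)))
    (h2 : Tendsto (fun ω : ℝ => I * ω * ZS ω) (𝓝[>] 0) (𝓝 (S : ℂ))) :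
    Tendsto (fun ω : ℝ => I * ω * Zsphere (ZM ω) (ZL ω) (ZS ω)) (𝓝[>] 0)
      (𝓝 ((3 / (1 / L + 2 / S) : ℝ) : ℂ)) := by
  have hL' : (L : ℂ) + 0 ≠ 0 := by
    rw [add_zero]; exact_mod_cast hL.ne'
  have hS' : (S : ℂ) + 0 ≠ 0 := by
    rw [add_zero]; exact_mod_cast hS.ne'
  have hD : (1 : ℂ) / ((L : ℂ) + 0) + 2 / ((S : ℂ) + 0) ≠ 0 := by
    rw [add_zero, add_zero]
    have : (1 / L + 2 / S : ℝ) ≠ 0 := by positivity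
    exact_mod_cast this
  have key := ((tendsto_const_nhds (x := (3 : ℂ))).div
    (((tendsto_const_nhds (x := (1 : ℂ))).div (h1.add hM) hL').add
      ((tendsto_const_nhds (x := (2 : ℂ))).div (h2.add hM) hS')) hD).sub hM
  have e : (3 : ℂ) / (1 / ((L : ℂ) + 0) + 2 / ((S : ℂ) + 0)) - 0
      = ((3 / (1 / L + 2 / S) : ℝ) : ℂ) := by
    push_cast; simp
  rw [e] at key
  refine key.congr' ?_
  filter_upwards [self_mem_nhdsWithin] with ω hω
  have hω' : I * (ω : ℂ) ≠ 0 :=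
    mul_ne_zero I_ne_zero (by exact_mod_cast (ne_of_gt hω))
  rw [Zsphere_scale _ _ _ _ hω']
  rfl

theorem ZMf_tendsto (a ρ : ℝ) :
    Tendsto (fun ω : ℝ => I * ω * ZMf a ρ ω) (𝓝[>] 0) (𝓝 0) := by
  have h : Continuous (fun ω : ℝ => I * ω * ZMf a ρ ω) := by
    unfold ZMf; fun_prop
  simpa using (h.tendsto 0).mono_left nhdsWithin_le_nhds

theorem wave_tendsto (C a c : ℝ) (g : ℝ → ℂ)
    (hg : ∀ ω, g ω = (I * ω)⁻¹ * C * (1 - I * (ω / c) * a)) :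
    Tendsto (fun ω : ℝ => I * ω * g ω) (𝓝[>] 0) (𝓝 (C : ℂ)) := by
  have h : Continuous (fun ω : ℝ => (C : ℂ) * (1 - I * (ω / c) * a)) := by
    simp only [div_eq_mul_inv]; fun_prop
  have h0 := (h.tendsto 0).mono_left (nhdsWithin_le_nhds (s := Set.Ioi 0))
  simp only [ofReal_zero, zero_div, mul_zero, zero_mul, sub_zero, mul_one] at h0
  refine h0.congr' ?_
  filter_upwards [self_mem_nhdsWithin] with ω hω
  have hω' : I * (ω : ℂ) ≠ 0 :=
    mul_ne_zero I_ne_zero (by exact_mod_cast (ne_of_gt hω))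
  have hfin := mul_inv_cancel_left₀ hω' ((C : ℂ) * (1 - I * (ω / c) * a))
  rw [hg, mul_assoc _ (C : ℂ), hfin]

/-- Quasistatic (Stokes-drag-like) limit of the sphere impedance, Eq. (19) of the
paper: `iωZ → 12πaμ/(2+κ⁻²)` for a perfectly bonded interface (`Z_S = Z_T`, `χ=0`)
and `iωZ → 12πaμ/(3+κ⁻²)` for a lubricated interface (`z_I = 0`, `χ=1`), where
`κ⁻² = μ/(λ+2μ)`. -/
theorem quasistatic_impedance_limit (a ρ lam mu : ℝ)
    (ha : 0 < a) (hρ : 0 < ρ) (hmu : 0 < mu) (hlam : 0 < lam + 2 * mu) :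
    Tendsto (fun ω : ℝ => (I * ω) *
        Zsphere (ZMf a ρ ω) (ZLf a ρ lam mu ω) (ZTf a ρ mu ω))
      (𝓝[>] 0)
      (𝓝 ((12 * Real.pi * a * mu : ℝ) / (2 + (mu / (lam + 2 * mu) : ℝ)))) ∧
    Tendsto (fun ω : ℝ => (I * ω) *
        Zsphere (ZMf a ρ ω) (ZLf a ρ lam mu ω)
          ((1 / ZTf a ρ mu ω + I * ω / (8 * Real.pi * a * mu))⁻¹))
      (𝓝[>] 0)
      (𝓝 ((12 * Real.pi * a * mu : ℝ) / (3 + (mu / (lam + 2 * mu) : ℝ)))) := by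
  have hpi := Real.pi_pos
  have hM := ZMf_tendsto a ρ
  have hL := wave_tendsto (4 * Real.pi * a * (lam + 2 * mu)) a
    (Real.sqrt ((lam + 2 * mu) / ρ)) (ZLf a ρ lam mu)
    (by intro ω; unfold ZLf; push_cast; rfl)
  have hT := wave_tendsto (4 * Real.pi * a * mu) a
    (Real.sqrt (mu / ρ)) (ZTf a ρ mu)
    (by intro ω; unfold ZTf; push_cast; rfl)
  have hTpos : 0 < 4 * Real.pi * a * mu := by positivity
  have hLpos : 0 < 4 * Real.pi * a * (lam + 2 * mu) := by positivity
  constructor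
  · have h := Zsphere_tendsto _ _ _ _ _ hLpos hTpos hM hL hT
    convert h using 2
    norm_cast
    field_simp
    ring
  · have hSpos : 0 < (1 / (4 * Real.pi * a * mu) + 1 / (8 * Real.pi * a * mu))⁻¹ := by
      positivity
    have hS : Tendsto (fun ω : ℝ => I * ω *
        (1 / ZTf a ρ mu ω + I * ω / (8 * Real.pi * a * mu))⁻¹) (𝓝[>] 0)
        (𝓝 (((1 / (4 * Real.pi * a * mu) + 1 / (8 * Real.pi * a * mu))⁻¹ : ℝ) : ℂ)) := by
      have hne : ((4 * Real.pi * a * mu : ℝ) : ℂ) ≠ 0 := by exact_mod_cast hTpos.ne'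
      have hne2 : (1 : ℂ) / ((4 * Real.pi * a * mu : ℝ) : ℂ)
          + 1 / (8 * Real.pi * a * mu) ≠ 0 := by
        have : (1 / (4 * Real.pi * a * mu) + 1 / (8 * Real.pi * a * mu) : ℝ) ≠ 0 := by
          positivity
        exact_mod_cast this
      have k := (((tendsto_const_nhds (x := (1 : ℂ))).div hT hne).add
        (tendsto_const_nhds (x := (1 : ℂ) / (8 * Real.pi * a * mu)))).inv₀ hne2
      have e : ((1 : ℂ) / ((4 * Real.pi * a * mu : ℝ) : ℂ)
          + 1 / (8 * Real.pi * a * mu))⁻¹ =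
          (((1 / (4 * Real.pi * a * mu) + 1 / (8 * Real.pi * a * mu))⁻¹ : ℝ) : ℂ) := by
        push_cast; rfl
      rw [e] at k
      refine k.congr' ?_
      filter_upwards [self_mem_nhdsWithin] with ω hω
      have hω' : I * (ω : ℂ) ≠ 0 :=
        mul_ne_zero I_ne_zero (by exact_mod_cast (ne_of_gt hω))
      change (1 / (I * ω * ZTf a ρ mu ω) + 1 / (8 * Real.pi * a * mu))⁻¹ = _
      generalize I * (ω : ℂ) = w at *
      have : 1 / ZTf a ρ mu ω + w / (8 * Real.pi * a * mu)
          = w * (1 / (w * ZTf a ρ mu ω) + 1 / (8 * Real.pi * a * mu)) := by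
        rw [mul_add, one_div (w * _), mul_inv, mul_inv_cancel_left₀ hω']
        ring
      rw [this, mul_inv, mul_inv_cancel_left₀ hω']
    have h := Zsphere_tendsto _ _ _ _ _ hLpos hSpos hM hL hS
    have e : (1 / (4 * Real.pi * a * mu) + 1 / (8 * Real.pi * a * mu))⁻¹
        = 8 * Real.pi * a * mu / 3 := by
      field_simp
      norm_num
    rw [e] at h
    convert h using 2
    norm_cast
    have e2 : 1 / (4 * Real.pi * a * (lam + 2 * mu)) + 2 / (8 * Real.pi * a * mu / 3)
        = (3 + mu / (lam + 2 * mu)) / (4 * Real.pi * a * mu) := by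
      field_simp
      ring
    rw [e2, div_div_eq_mul_div]
    congr 1
    ring
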